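/- Let n ≥ 3 be an integer, F a field, and q, κ ∈ Fˣ units with q² ≠ 1. Then for every k ∈ ℤ the determinant of the n×n matrix G(n,k,κ) (with (i,j) entry [k·a_{ij}]·κ^{−k·m_{ij}}) equals q^{−nk}·[k]^n·(q^{nk} − κ^{nk})·(q^{nk} − κ^{−nk}). In particular, when [k] ≠ 0 the matrix G(n,k,κ) is singular if and only if κ^{nk} = q^{nk} or κ^{nk} = q^{−nk}. -/

import Mathlib

noncomputable section

variable (F : Type*) [Field F]

/-- The `q`-integer `[m] = (q^m - q^{-m})/(q - q^{-1})`. -/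
def qint (q : Fˣ) (m : ℤ) : F :=
  (((q ^ m : Fˣ) : F) - ((q ^ (-m) : Fˣ) : F)) / ((q : F) - ((q⁻¹ : Fˣ) : F))

/-- The affine Cartan matrix of type `A_{n-1}^{(1)}`. -/
def aMat (n : ℕ) (i j : Fin n) : ℤ :=
  if i = j then 2
  else if (j : ZMod n) = (i : ZMod n) + 1 ∨ (j : ZMod n) = (i : ZMod n) - 1 then -1
  else 0

/-- The matrix `(m_{ij})`. -/
def mMat (n : ℕ) (i j : Fin n) : ℤ :=
  if (j : ZMod n) = (i : ZMod n) + 1 then -1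
  else if (j : ZMod n) = (i : ZMod n) - 1 then 1
  else 0

/-- The matrix `G(n,k,κ)` with entries `[k⬝a_{ij}]⬝κ^{-k⬝m_{ij}}`. -/
def Gmat (n : ℕ) (q κ : Fˣ) (k : ℤ) : Matrix (Fin n) (Fin n) F :=
  fun i j => qint F q (k * aMat n i j) * ((κ ^ (-(k * mMat n i j)) : Fˣ) : F)

open scoped Fin.CommRing in
lemma Fin.forall_of_forall_add_one {m : ℕ} {p : Fin (m + 1) → Prop} {i₀ : Fin (m + 1)}
    (h₀ : p i₀) (h : ∀ i, p i → p (i + 1)) (i : Fin (m + 1)) : p i := by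
  have key : ∀ r : ℕ, p (i₀ + (r : Fin (m + 1))) := by
    intro r
    induction r with
    | zero => simpa using h₀
    | succ r ih =>
      rw [Nat.cast_succ, ← add_assoc]
      exact h _ ih
  have hi := key (i - i₀ : Fin (m + 1)).val
  rwa [Fin.cast_val_eq_self, add_sub_cancel] at hi

lemma Equiv.Perm.eq_one_or_eq_finRotate {m : ℕ} {σ : Equiv.Perm (Fin (m + 1))}
    (h : ∀ i, σ i = i ∨ σ i = i + 1) : σ = 1 ∨ σ = finRotate (m + 1) := by
  by_cases hσ : ∃ i, σ i ≠ i
  · obtain ⟨i₀, hi₀⟩ := hσ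
    right
    have key : ∀ i, σ i ≠ i := by
      refine Fin.forall_of_forall_add_one hi₀ fun i hi hfix => hi ?_
      have hi' := (h i).resolve_left hi
      have := σ.injective (hi'.trans hfix.symm)
      rw [hi', ← this]
    ext1 i
    rw [finRotate_apply]
    exact (h i).resolve_left (key i)
  · push Not at hσ
    exact Or.inl (Equiv.ext hσ)

lemma Matrix.det_smul_one_sub_smul_permMatrix_finRotate {R : Type*} [CommRing R] {m : ℕ}
    (hm : m ≠ 0) (a b : R) :
    (a • (1 : Matrix (Fin (m + 1)) (Fin (m + 1)) R) -
      b • (finRotate (m + 1)).permMatrix R).det = a ^ (m + 1) - b ^ (m + 1) := by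
  obtain ⟨m, rfl⟩ := Nat.exists_eq_add_one_of_ne_zero hm
  have entry : ∀ i j, (a • (1 : Matrix (Fin (m + 1 + 1)) (Fin (m + 1 + 1)) R) -
      b • (finRotate (m + 1 + 1)).permMatrix R) i j =
      (if j = i then a else 0) - if j = i + 1 then b else 0 := by
    intro i j
    simp [Matrix.one_apply, PEquiv.toMatrix_apply, Equiv.toPEquiv_apply, eq_comm]
  have hne : ∀ i : Fin (m + 1 + 1), i + 1 ≠ i := by simp
  have hrot : (1 : Equiv.Perm (Fin (m + 1 + 1))) ≠ finRotate (m + 1 + 1) := by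
    intro h
    have := congrArg (fun σ => σ 0) h
    simp at this
  rw [← Matrix.det_transpose, Matrix.det_apply',
    ← Finset.sum_subset (Finset.subset_univ {1, finRotate (m + 1 + 1)}),
    Finset.sum_pair hrot]
  · simp only [Matrix.transpose_apply, entry, finRotate_apply, Equiv.Perm.one_apply, hne,
      fun i => (hne i).symm, if_true, if_false, sign_finRotate, Finset.prod_const,
      Finset.card_univ, Fintype.card_fin, Equiv.Perm.sign_one]
    have hsq : ((-1 : R) ^ m) * (-1) ^ m = 1 := by rw [← mul_pow]; simp
    push_cast
    rw [zero_sub, neg_pow b]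
    linear_combination (- b ^ (m + 2)) * hsq
  · intro σ _ hσ
    have : ¬ ∀ i, σ i = i ∨ σ i = i + 1 := fun h => hσ <| by
      simpa using Equiv.Perm.eq_one_or_eq_finRotate h
    push Not at this
    obtain ⟨i, hi, hi'⟩ := this
    rw [Finset.prod_eq_zero (Finset.mem_univ i), mul_zero]
    simp [Matrix.transpose_apply, entry, hi, hi']

lemma qint_zero (q : Fˣ) : qint F q 0 = 0 := by simp [qint]

lemma qint_neg (q : Fˣ) (m : ℤ) : qint F q (-m) = -qint F q m := by
  simp only [qint, neg_neg]
  ring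

lemma qint_mul_two (q : Fˣ) (m : ℤ) :
    qint F q (m * 2) = qint F q m * (((q ^ m : Fˣ) : F) + ((q ^ (-m) : Fˣ) : F)) := by
  simp only [qint, mul_two, neg_add, zpow_add, Units.val_mul]
  ring

open scoped Matrix in
lemma Gmat_eq (m : ℕ) (hm : 2 ≤ m) (q κ : Fˣ) (k : ℤ) :
    Gmat F (m + 1) q κ k = (qint F q k * ((q ^ (-k) : Fˣ) : F)) •
      ((((q ^ k : Fˣ) : F) • (1 : Matrix (Fin (m + 1)) (Fin (m + 1)) F) -
          ((κ ^ k : Fˣ) : F) • (finRotate (m + 1)).permMatrix F) *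
        (((q ^ k : Fˣ) : F) • (1 : Matrix (Fin (m + 1)) (Fin (m + 1)) F) -
          ((κ ^ (-k) : Fˣ) : F) • (finRotate (m + 1)).permMatrix F)ᵀ) := by
  have hQ : ((q ^ (-k) : Fˣ) : F) * ((q ^ k : Fˣ) : F) = 1 := by
    rw [← Units.val_mul, ← zpow_add]; simp
  have hK : ((κ ^ k : Fˣ) : F) * ((κ ^ (-k) : Fˣ) : F) = 1 := by
    rw [← Units.val_mul, ← zpow_add]; simp
  have hP : (finRotate (m + 1)).permMatrix F * ((finRotate (m + 1)).permMatrix F)ᵀ = 1 := by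
    rw [Matrix.transpose_permMatrix, ← Matrix.permMatrix_mul]; simp
  have hfac : (((q ^ k : Fˣ) : F) • (1 : Matrix (Fin (m + 1)) (Fin (m + 1)) F) -
          ((κ ^ k : Fˣ) : F) • (finRotate (m + 1)).permMatrix F) *
        (((q ^ k : Fˣ) : F) • (1 : Matrix (Fin (m + 1)) (Fin (m + 1)) F) -
          ((κ ^ (-k) : Fˣ) : F) • (finRotate (m + 1)).permMatrix F)ᵀ =
      (((q ^ k : Fˣ) : F) * ((q ^ k : Fˣ) : F) + 1) • (1 : Matrix (Fin (m + 1)) (Fin (m + 1)) F) -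
      (((q ^ k : Fˣ) : F) * ((κ ^ k : Fˣ) : F)) • (finRotate (m + 1)).permMatrix F -
      (((q ^ k : Fˣ) : F) * ((κ ^ (-k) : Fˣ) : F)) • ((finRotate (m + 1)).permMatrix F)ᵀ := by
    rw [Matrix.transpose_sub, Matrix.transpose_smul, Matrix.transpose_smul, Matrix.transpose_one]
    simp only [sub_mul, mul_sub, smul_mul_assoc, mul_smul_comm, one_mul, mul_one, smul_smul, hP,
      add_smul, one_smul, smul_sub]
    rw [mul_comm ((κ ^ (-k) : Fˣ) : F) ((κ ^ k : Fˣ) : F), hK, one_smul,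
      mul_comm ((κ ^ (-k) : Fˣ) : F)]
    abel
  have h1 : ∀ i : Fin (m + 1), i ≠ i + 1 := by
    intro i h
    simp at h
    omega
  have h2 : ∀ i : Fin (m + 1), i ≠ i + 1 + 1 := by
    intro i h
    rw [add_assoc, left_eq_add, Fin.ext_iff] at h
    have h1v : ((1 : Fin (m + 1)) : ℕ) = 1 := by
      rw [Fin.val_one', Nat.mod_eq_of_lt (by omega)]
    rw [Fin.val_add, h1v, Nat.mod_eq_of_lt (by omega)] at h
    simp at h
  have hsucc : ∀ i j : Fin (m + 1),
      ((j : ℕ) : ZMod (m + 1)) = ((i : ℕ) : ZMod (m + 1)) + 1 ↔ j = i + 1 := by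
    intro i j
    have hcast : ∀ i : Fin (m + 1), ((i : ℕ) : ZMod (m + 1)) = i :=
      fun i => Fin.cast_val_eq_self i
    rw [hcast, hcast]
    rfl
  have hpred : ∀ i j : Fin (m + 1),
      ((j : ℕ) : ZMod (m + 1)) = ((i : ℕ) : ZMod (m + 1)) - 1 ↔ i = j + 1 := by
    intro i j
    rw [eq_sub_iff_add_eq, eq_comm]
    exact hsucc j i
  have hperm : ∀ i j, (finRotate (m + 1)).permMatrix F i j = if j = i + 1 then 1 else 0 := by
    intro i j
    simp [PEquiv.toMatrix_apply, Equiv.toPEquiv_apply, eq_comm]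
  rw [hfac]
  ext i j
  simp only [Gmat, aMat, mMat, hsucc, hpred, Matrix.smul_apply, Matrix.sub_apply, Matrix.one_apply,
    Matrix.transpose_apply, hperm, smul_eq_mul]
  by_cases hij : i = j
  · subst hij
    simp only [h1, if_true, if_false, qint_mul_two]
    simp only [mul_zero, neg_zero, zpow_zero, Units.val_one]
    linear_combination (-(qint F q k) * ((q ^ k : Fˣ) : F)) * hQ
  by_cases hj : j = i + 1
  · subst hj
    simp only [h1, h2, if_true, if_false, true_or, mul_neg, mul_one, neg_neg, qint_neg]
    linear_combination (qint F q k * ((κ ^ k : Fˣ) : F)) * hQ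
  by_cases hi : i = j + 1
  · subst hi
    simp only [hij, hj, if_true, if_false, or_true, mul_neg, mul_one, qint_neg]
    linear_combination (qint F q k * ((κ ^ (-k) : Fˣ) : F)) * hQ
  · simp [hij, hj, hi, qint_zero]

lemma det_Gmat (n : ℕ) (hn : 3 ≤ n) (q κ : Fˣ) (k : ℤ) :
    (Gmat F n q κ k).det =
      ((q ^ (-((n : ℤ) * k)) : Fˣ) : F) * (qint F q k) ^ n *
        (((q ^ ((n : ℤ) * k) : Fˣ) : F) - ((κ ^ ((n : ℤ) * k) : Fˣ) : F)) *
        (((q ^ ((n : ℤ) * k) : Fˣ) : F) - ((κ ^ (-((n : ℤ) * k)) : Fˣ) : F)) := by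
  obtain ⟨m, rfl⟩ : ∃ m, n = m + 1 := ⟨n - 1, by omega⟩
  have hpow : ∀ (u : Fˣ) (l : ℤ),
      ((u ^ (((m + 1 : ℕ) : ℤ) * l) : Fˣ) : F) = ((u ^ l : Fˣ) : F) ^ (m + 1) := by
    intro u l
    rw [mul_comm, zpow_mul, zpow_natCast, Units.val_pow_eq_pow_val]
  rw [Gmat_eq F m (by omega), Matrix.det_smul, Matrix.det_mul, Matrix.det_transpose,
    Matrix.det_smul_one_sub_smul_permMatrix_finRotate (by omega),
    Matrix.det_smul_one_sub_smul_permMatrix_finRotate (by omega), Fintype.card_fin,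
    ← mul_neg, hpow, hpow, hpow, hpow, mul_pow]
  ring

theorem statement0 (n : ℕ) (hn : 3 ≤ n) (q κ : Fˣ) (hq : (q : F) ^ 2 ≠ 1) (k : ℤ) :
    (Gmat F n q κ k).det =
      ((q ^ (-((n : ℤ) * k)) : Fˣ) : F) * (qint F q k) ^ n *
        (((q ^ ((n : ℤ) * k) : Fˣ) : F) - ((κ ^ ((n : ℤ) * k) : Fˣ) : F)) *
        (((q ^ ((n : ℤ) * k) : Fˣ) : F) - ((κ ^ (-((n : ℤ) * k)) : Fˣ) : F)) ∧
    (qint F q k ≠ 0 →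
      (¬ IsUnit (Gmat F n q κ k) ↔
        κ ^ ((n : ℤ) * k) = q ^ ((n : ℤ) * k) ∨ κ ^ ((n : ℤ) * k) = q ^ (-((n : ℤ) * k)))) := by
  refine ⟨det_Gmat F n hn q κ k, fun hk => ?_⟩
  rw [Matrix.isUnit_iff_isUnit_det, isUnit_iff_ne_zero, not_not, det_Gmat F n hn q κ k]
  simp only [mul_eq_zero, Units.ne_zero, pow_eq_zero_iff (show n ≠ 0 by omega), hk, false_or,
    sub_eq_zero, Units.val_inj]
  refine or_congr eq_comm ?_
  rw [zpow_neg, zpow_neg, eq_comm, inv_eq_iff_eq_inv]
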